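/- arXiv:2210.09631 — 5 statements merged into one kernel-verified Lean document; each statement's English description precedes it below -/
import Mathlib

section
/- Let n ≥ 507 be an integer and make the parameter choices d_0 = n*/2, d = n*, a = 1/4, c = 32/45, b = 1 − √(2n+1/8)/(c·n²/(n−1)+2), and set Q_1 = p_0(n)^(n*−d_0)/K_{d_0}(n). Then: (i) 0 ≤ d_0 ≤ n* − 1.4 and 1 < d ≤ n*; (ii) Q_1^(d−1) > max(1, K_d(n)); (iii) 0 < a < b < 1 − √(2(n+a²)/n²); (iv) χ_n ≥ 2 and π_n ≥ 5·log 2 + 2·log n; (v) T = 2, where T = ⌊max( log( χ_n·n·(d−1)/(d_0·(d−1)+d) + 1 )/log d , log( π_n / log(K_d(n)^(−1/(d−1))·Q_1) + 1 )/log d )⌋ + 2; and (vi) Z = 2, where Z = ⌊( log E + 2·log n − log(L−2) )/log(n−1)⌋ + 2. -/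
/-- `n* = (n-2)/2`. -/
noncomputable def nstar (n : ℕ) : ℝ := ((n : ℝ) - 2) / 2

/-- `p₀(n) = 3` for `6 ≤ n ≤ 8` and `p₀(n) = 2` for `n ≥ 9`. -/
noncomputable def p0 (n : ℕ) : ℝ := if n ≤ 8 then 3 else 2

/-- `K_d(n) = m_n (r_n (1 + u_n))^d`. -/
noncomputable def Kd (d : ℝ) (n : ℕ) : ℝ :=
  (2 * Real.sqrt (2 * n / (((n : ℝ) - 1) * ((n : ℝ) - 2)))) *
    ((2.032 : ℝ) ^ ((1 : ℝ) / n) * (1 + Real.sqrt (2 / (((n : ℝ) - 2) * p0 n ^ n)))) ^ d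

lemma p0_eq_two {n : ℕ} (hn : 507 ≤ n) : p0 n = 2 := by
  unfold p0
  rw [if_neg (by omega)]

lemma Kd_pos {n : ℕ} (hn : 507 ≤ n) (x : ℝ) : 0 < Kd x n := by
  have hN : (507 : ℝ) ≤ n := by exact_mod_cast hn
  have h1 : 0 < (n : ℝ) - 1 := by linarith
  have h2 : 0 < (n : ℝ) - 2 := by linarith
  unfold Kd
  positivity

lemma Kd_lt_one {n : ℕ} (hn : 507 ≤ n) {x : ℝ} (hx0 : 0 ≤ x) (hx : x ≤ n / 2) :
    Kd x n < 1 := by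
  have hN : (507 : ℝ) ≤ n := by exact_mod_cast hn
  have h1 : 0 < (n : ℝ) - 1 := by linarith
  have h2 : 0 < (n : ℝ) - 2 := by linarith
  have hn0 : (0 : ℝ) < n := by linarith
  unfold Kd
  rw [p0_eq_two hn]
  have hm : 2 * √(2 * n / (((n : ℝ) - 1) * ((n : ℝ) - 2))) ≤ 1 / 7 := by
    have : √(2 * n / (((n : ℝ) - 1) * ((n : ℝ) - 2))) ≤ 1 / 14 := by
      rw [Real.sqrt_le_left (by norm_num), div_le_iff₀ (by positivity)]
      nlinarith
    linarith
  have hu : √(2 / (((n : ℝ) - 2) * 2 ^ n)) ≤ 2 / n := by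
    have hpow : (n : ℝ) ≤ 2 ^ n := by exact_mod_cast Nat.lt_two_pow_self.le
    rw [Real.sqrt_le_left (by positivity), div_pow, div_le_div_iff₀ (by positivity) (by positivity)]
    have : ((n : ℝ) - 2) * n ≤ (n - 2) * 2 ^ n := by gcongr
    nlinarith
  have hxn : x / n ≤ 1 / 2 := by
    rw [div_le_iff₀ hn0]; linarith
  have hr : ((2.032 : ℝ) ^ ((1 : ℝ) / n)) ^ x ≤ 2.032 := by
    rw [← Real.rpow_mul (by norm_num)]
    calc (2.032 : ℝ) ^ (1 / (n : ℝ) * x) ≤ 2.032 ^ (1 : ℝ) :=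
          Real.rpow_le_rpow_of_exponent_le (by norm_num)
            (by rw [one_div_mul_eq_div]; linarith)
      _ = 2.032 := Real.rpow_one _
  have hv : (1 + √(2 / (((n : ℝ) - 2) * 2 ^ n))) ^ x ≤ 2.72 := by
    calc (1 + √(2 / (((n : ℝ) - 2) * 2 ^ n))) ^ x ≤ (Real.exp (2 / n)) ^ x := by
          gcongr
          linarith [Real.add_one_le_exp (2 / (n : ℝ))]
      _ = Real.exp (2 * (x / n)) := by rw [← Real.exp_mul]; ring_nf
      _ ≤ Real.exp 1 := by gcongr; linarith
      _ ≤ 2.72 := by linarith [Real.exp_one_lt_d9]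
  rw [Real.mul_rpow (by positivity) (by positivity)]
  calc _ ≤ (1 / 7 : ℝ) * (2.032 * 2.72) := by gcongr
    _ < 1 := by norm_num

lemma log_div_log_mem_Ico {x y : ℝ} (hx : 1 ≤ x) (hxy : x < y) :
    Real.log x / Real.log y ∈ Set.Ico (0 : ℝ) 1 := by
  have hy : 0 < Real.log y := Real.log_pos (by linarith)
  exact ⟨div_nonneg (Real.log_nonneg hx) hy.le,
    (div_lt_one hy).2 (Real.log_lt_log (by linarith) hxy)⟩

set_option maxHeartbeats 400000 in
theorem stmt9 (n : ℕ) (hn : 507 ≤ n)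
    (d0 d a c b Q1 L D A E chi piN : ℝ) (T Z : ℤ)
    (hd0 : d0 = nstar n / 2) (hd : d = nstar n)
    (ha : a = 1 / 4) (hc : c = 32 / 45)
    (hb : b = 1 - Real.sqrt (2 * n + 1 / 8) / (c * n ^ 2 / ((n : ℝ) - 1) + 2))
    (hQ1 : Q1 = p0 n ^ (nstar n - d0) / Kd d0 n)
    (hL : L = Real.sqrt (2 * (n + a ^ 2)) / (1 - b))
    (hD : D = L / ((n : ℝ) - L))
    (hA : A = 1 / a ^ 2)
    (hE : E = 1 / (2 * (b ^ 2 - a ^ 2)))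
    (hchi : chi = D * (A + 1) + 1)
    (hpiN : piN = (D * (4 + A) + 2) * Real.log 2 + (D + 1) * Real.log n / 2 + n * A * D / 2)
    (hT : T = ⌊max (Real.log (chi * n * (d - 1) / (d0 * (d - 1) + d) + 1) / Real.log d)
        (Real.log (piN / Real.log (Kd d n ^ (-1 / (d - 1)) * Q1) + 1) / Real.log d)⌋ + 2)
    (hZ : Z = ⌊(Real.log E + 2 * Real.log n - Real.log (L - 2)) / Real.log ((n : ℝ) - 1)⌋ + 2) :
    (0 ≤ d0 ∧ d0 ≤ nstar n - 1.4) ∧ (1 < d ∧ d ≤ nstar n) ∧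
      max 1 (Kd d n) < Q1 ^ (d - 1) ∧
      (0 < a ∧ a < b ∧ b < 1 - Real.sqrt (2 * (n + a ^ 2) / n ^ 2)) ∧
      (2 ≤ chi ∧ 5 * Real.log 2 + 2 * Real.log n ≤ piN) ∧
      T = 2 ∧ Z = 2 := by
  have hN : (507 : ℝ) ≤ n := by exact_mod_cast hn
  have hn0 : (0 : ℝ) < n := by linarith
  have h1 : 0 < (n : ℝ) - 1 := by linarith
  have hdn : d = ((n : ℝ) - 2) / 2 := hd
  have hd0d : d0 = d / 2 := by rw [hd0, hd]
  have hdge : 252.5 ≤ d := by rw [hdn]; linarith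
  have hnd : (n : ℝ) = 2 * d + 2 := by rw [hdn]; ring
  rw [← hd] at hQ1 ⊢
  subst ha hc
  set M : ℝ := 32 / 45 * (n : ℝ) ^ 2 / ((n : ℝ) - 1) with hM
  have hMlow : 32 / 45 * (n : ℝ) ≤ M := by
    rw [hM, le_div_iff₀ h1]; nlinarith only [hN]
  have hMup : M + 2 ≤ 13 / 18 * n := by
    have : M ≤ 13 / 18 * n - 2 := by
      rw [hM, div_le_iff₀ h1]; nlinarith only [hN]
    linarith
  set s : ℝ := √(2 * n + 1 / 8) with hs
  have hspos : 0 < s := by rw [hs]; positivity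
  have hb1 : 1 - b = s / (M + 2) := by rw [hb]; ring
  have hLs : √(2 * ((n : ℝ) + (1 / 4) ^ 2)) = s := by rw [hs]; congr 1; ring
  have hLM : L = M + 2 := by
    rw [hL, hLs, hb1]; field_simp
  have hb8 : 1 - b < 1 / 8 := by
    rw [hb1, div_lt_iff₀ (by linarith), hs, Real.sqrt_lt' (by linarith)]
    nlinarith only [hN, hMlow]
  have hblt : b < 1 - √(2 * ((n : ℝ) + (1 / 4) ^ 2) / (n : ℝ) ^ 2) := by
    have : √(2 * ((n : ℝ) + (1 / 4) ^ 2) / (n : ℝ) ^ 2) < 1 - b := by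
      rw [Real.sqrt_div' _ (by positivity), hLs, Real.sqrt_sq hn0.le, hb1]
      exact div_lt_div_of_pos_left hspos (by linarith) (by linarith)
    linarith
  have hbone : b < 1 := by
    have : 0 < 1 - b := by rw [hb1]; exact div_pos hspos (by linarith)
    linarith
  have hDlow : 2 ≤ D := by
    rw [hD, hLM, le_div_iff₀ (by linarith)]; linarith
  have hDup : D ≤ 2.6 := by
    rw [hD, hLM, div_le_iff₀ (by linarith)]; linarith
  have hA16 : A = 16 := by rw [hA]; norm_num
  rw [hA16] at hchi hpiN
  have hlogn0 : 0 ≤ Real.log n := Real.log_nonneg (by linarith)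
  have hlogn : Real.log n ≤ n := Real.log_le_self hn0.le
  have hl2 := Real.log_two_gt_d9
  have hl2' := Real.log_two_lt_d9
  have hDlog : D * Real.log n ≤ 2.6 * Real.log n := by gcongr
  have hDlog' : 2 * Real.log n ≤ D * Real.log n := by gcongr
  have hDlog2 : D * Real.log 2 ≤ 2.6 * Real.log 2 := by gcongr
  have hDlog2' : 2 * Real.log 2 ≤ D * Real.log 2 := by gcongr
  have hDn : n * D ≤ n * 2.6 := by gcongr
  have hDn' : n * 2 ≤ n * D := by gcongr
  have hpilow : 5 * Real.log 2 + 2 * Real.log n ≤ piN := by rw [hpiN]; linarith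
  have hpiup : piN ≤ 40 + 23 * n := by rw [hpiN]; linarith
  have hKd := Kd_pos hn d
  have hKd0 := Kd_pos hn d0
  have hKd1 : Kd d n < 1 := Kd_lt_one hn (by linarith) (by linarith)
  have hKd01 : Kd d0 n < 1 := Kd_lt_one hn (by linarith) (by linarith)
  have hpow : (1 : ℝ) < 2 ^ (d - d0) := Real.one_lt_rpow (by norm_num) (by linarith)
  rw [p0_eq_two hn] at hQ1
  have hQgt : (1 : ℝ) < Q1 := by
    rw [hQ1, lt_div_iff₀ hKd0]; linarith
  have hlog : d / 2 * Real.log 2 ≤ Real.log (Kd d n ^ (-1 / (d - 1)) * Q1) := by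
    rw [← Real.log_rpow (by norm_num)]
    apply Real.log_le_log (by positivity)
    have hone : 1 ≤ Kd d n ^ (-1 / (d - 1)) :=
      Real.one_le_rpow_of_pos_of_le_one_of_nonpos hKd hKd1.le
        (div_nonpos_of_nonpos_of_nonneg (by norm_num) (by linarith))
    have hQle : (2 : ℝ) ^ (d / 2) ≤ Q1 := by
      rw [hQ1, show d - d0 = d / 2 by rw [hd0d]; ring]
      exact le_div_self (by positivity) hKd0 hKd01.le
    exact hQle.trans (le_mul_of_one_le_left (by linarith) hone)
  refine ⟨⟨by linarith, by norm_num; linarith⟩, ⟨by linarith, le_rfl⟩, ?_,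
    ⟨by norm_num, by linarith, hblt⟩, ⟨by rw [hchi]; linarith, hpilow⟩, ?_, ?_⟩
  · rw [max_eq_left hKd1.le]
    exact Real.one_lt_rpow hQgt (by linarith)
  · have hden : 0 < d0 * (d - 1) + d := by
      have : 0 ≤ d0 * (d - 1) := mul_nonneg (by linarith) (by linarith)
      linarith
    have hchi0 : 0 ≤ chi := by rw [hchi]; linarith
    have hchiup : chi ≤ 46 := by rw [hchi]; linarith
    have hq : n * (d - 1) / (d0 * (d - 1) + d) ≤ 4 := by
      rw [div_le_iff₀ hden, hd0d, hnd]; nlinarith only [hdge]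
    have hq0 : 0 ≤ n * (d - 1) / (d0 * (d - 1) + d) :=
      div_nonneg (mul_nonneg hn0.le (by linarith)) hden.le
    have hchiq0 := mul_nonneg hchi0 hq0
    have hchiq := mul_le_mul hchiup hq hq0 (by norm_num)
    have hfst := log_div_log_mem_Ico (x := chi * n * (d - 1) / (d0 * (d - 1) + d) + 1) (y := d)
      (by rw [mul_assoc, mul_div_assoc]; linarith)
      (by rw [mul_assoc, mul_div_assoc]; linarith)
    have hlogpos : 0 < Real.log (Kd d n ^ (-1 / (d - 1)) * Q1) :=
      (mul_pos (by linarith) (by linarith)).trans_le hlog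
    have hsnd := log_div_log_mem_Ico
      (x := piN / Real.log (Kd d n ^ (-1 / (d - 1)) * Q1) + 1) (y := d)
      (by linarith [div_nonneg (show 0 ≤ piN by linarith) hlogpos.le])
      (by
        have : piN / Real.log (Kd d n ^ (-1 / (d - 1)) * Q1) < d - 1 := by
          rw [div_lt_iff₀ hlogpos]
          have h3 : (d - 1) * (d / 2 * 0.69) ≤
              (d - 1) * Real.log (Kd d n ^ (-1 / (d - 1)) * Q1) := by
            apply mul_le_mul_of_nonneg_left _ (by linarith)
            exact (mul_le_mul_of_nonneg_left (by linarith) (by linarith)).trans hlog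
          nlinarith only [h3, hpiup, hnd, hdge]
        linarith)
    rw [hT, Int.floor_eq_zero_iff.2 ⟨le_max_of_le_left hfst.1, max_lt hfst.2 hsnd.2⟩]
    norm_num
  · have hbb : 45 / 32 < 2 * (b ^ 2 - (1 / 4) ^ 2) := by nlinarith only [hb8]
    have hbb2 : 2 * (b ^ 2 - (1 / 4) ^ 2) ≤ 2 := by nlinarith only [hb8, hbone]
    have hEup : E < 32 / 45 := by
      rw [hE, div_lt_iff₀ (by linarith)]; linarith
    have hElow : 1 / 2 ≤ E := by
      rw [hE, le_div_iff₀ (by linarith)]; linarith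
    have hnum : Real.log E + 2 * Real.log n - Real.log (L - 2) =
        Real.log (E * (n - 1) / (32 / 45)) := by
      rw [show L - 2 = M by rw [hLM]; ring, ← Real.log_rpow hn0,
        ← Real.log_mul (by positivity) (by positivity),
        ← Real.log_div (by positivity) (by linarith), hM, Real.rpow_ofNat]
      congr 1
      field_simp
    have hmem := log_div_log_mem_Ico (x := E * (n - 1) / (32 / 45)) (y := (n : ℝ) - 1)
      (by rw [le_div_iff₀ (by norm_num)]; nlinarith only [hElow, hN])
      (by rw [div_lt_iff₀ (by norm_num)]; nlinarith only [hEup, h1])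
    rw [hZ, hnum, Int.floor_eq_zero_iff.2 hmem]
    norm_num
end

section
/- Let n ≥ 507 be an integer with the parameter choices a = 1/4, c = 32/45, and b = 1 − √(2n+1/8)/(c·n²/(n−1)+2). Then 42.8 ≤ χ_n ≤ 44.08 and 46 + 19n ≤ π_n ≤ 37 + 21n. -/
theorem stmt10 (n : ℕ) (hn : 507 ≤ n)
    (a c b L D A chi piN : ℝ)
    (ha : a = 1 / 4) (hc : c = 32 / 45)
    (hb : b = 1 - Real.sqrt (2 * n + 1 / 8) / (c * n ^ 2 / ((n : ℝ) - 1) + 2))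
    (hL : L = Real.sqrt (2 * (n + a ^ 2)) / (1 - b))
    (hD : D = L / ((n : ℝ) - L))
    (hA : A = 1 / a ^ 2)
    (hchi : chi = D * (A + 1) + 1)
    (hpiN : piN = (D * (4 + A) + 2) * Real.log 2 + (D + 1) * Real.log n / 2 + n * A * D / 2) :
    (42.8 ≤ chi ∧ chi ≤ 44.08) ∧ (46 + 19 * n ≤ piN ∧ piN ≤ 37 + 21 * n) := by
  have hx : (507 : ℝ) ≤ n := by exact_mod_cast hn
  generalize (n : ℝ) = x at *
  have hA' : A = 16 := by rw [hA, ha]; norm_num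
  have hL' : L = 32 / 45 * x ^ 2 / (x - 1) + 2 := by
    have hs : Real.sqrt (2 * x + 1 / 8) ≠ 0 := by positivity
    have harg : 2 * (x + a ^ 2) = 2 * x + 1 / 8 := by rw [ha]; ring
    rw [hL, hb, harg, sub_sub_cancel, div_div_cancel₀ hs, hc]
  have hx1 : 0 < x - 1 := by linarith
  have hL_lower : 32 / 45 * x ≤ L := by
    have : 32 / 45 * x ≤ 32 / 45 * x ^ 2 / (x - 1) := by
      rw [le_div_iff₀ hx1]; nlinarith
    linarith
  have hL_upper : L ≤ 0.717 * x := by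
    have : 32 / 45 * x ^ 2 / (x - 1) ≤ 0.717 * x - 2 := by
      rw [div_le_iff₀ hx1]; nlinarith
    linarith
  have hxL : 0 < x - L := by linarith
  have hD_lower : 32 / 13 ≤ D := by rw [hD, le_div_iff₀ hxL]; linarith
  have hD_upper : D ≤ 2.534 := by rw [hD, div_le_iff₀ hxL]; linarith
  have hlog2_lower := Real.log_two_gt_d9
  have hlog2_upper := Real.log_two_lt_d9
  have hlog_nonneg : 0 ≤ Real.log x := Real.log_nonneg (by linarith)
  have hlog_upper : Real.log x ≤ x / 8 + 2 := by
    have h := Real.log_le_sub_one_of_pos (show 0 < x / 8 by linarith)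
    rw [Real.log_div (by linarith) (by norm_num), show (8 : ℝ) = 2 ^ 3 by norm_num,
      Real.log_pow] at h
    push_cast at h
    linarith
  subst hA' hchi hpiN
  refine ⟨⟨by linarith, by linarith⟩, ?_, ?_⟩
  · have h1 : (32 / 13 * 20 + 2) * 0.69 ≤ (D * (4 + 16) + 2) * Real.log 2 := by
      gcongr <;> linarith
    have h2 : 0 ≤ (D + 1) * Real.log x := mul_nonneg (by linarith) hlog_nonneg
    have h3 : 32 / 13 * x ≤ D * x := by gcongr
    linarith
  · have h1 : (D * (4 + 16) + 2) * Real.log 2 ≤ (2.534 * 20 + 2) * 0.7 := by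
      gcongr <;> linarith
    have h2 : (D + 1) * Real.log x ≤ (2.534 + 1) * (x / 8 + 2) := by gcongr
    have h3 : D * x ≤ 2.534 * x := by gcongr
    linarith
end

section
/- Let n ≥ 9 be an integer. Then K_{n*/2}(n) ≤ 5·e^(1/4) and K_{n*}(n) ≤ 5·e^(1/2). -/
theorem eight_mul_le_two_pow {n : ℕ} (hn : 9 ≤ n) : 8 * (n : ℝ) ≤ 2 ^ n := by
  have h : 8 * n ≤ 2 ^ n := by
    induction n, hn using Nat.le_induction with
    | base => norm_num
    | succ k hk ih => rw [pow_succ]; omega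
  exact_mod_cast h

theorem sqrt_div_p0_pow_le {n : ℕ} (hn : 9 ≤ n) :
    Real.sqrt (2 / (((n : ℝ) - 2) * p0 n ^ n)) ≤ 1 / (2 * ((n : ℝ) - 2)) := by
  have hn' : (9 : ℝ) ≤ n := by exact_mod_cast hn
  have hpos : 0 < (n : ℝ) - 2 := by linarith
  have hp : p0 n = 2 := if_neg (by omega)
  have hpow := eight_mul_le_two_pow hn
  rw [hp]
  apply Real.sqrt_le_iff.mpr
  refine ⟨by positivity, ?_⟩
  rw [div_pow, div_le_div_iff₀ (by positivity) (by positivity)]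
  nlinarith [mul_nonneg hpos.le (show 0 ≤ (2 : ℝ) ^ n - 8 * ((n : ℝ) - 2) by linarith)]

/-- For `n ≥ 9` the bound `5 e^(1/4)` holds uniformly for all `d` between `0` and `n*`. -/
theorem Kd_le {n : ℕ} (hn : 9 ≤ n) {d : ℝ} (hd : 0 ≤ d) (hdn : d ≤ nstar n) :
    Kd d n ≤ 5 * Real.exp (1 / 4) := by
  have hn' : (9 : ℝ) ≤ n := by exact_mod_cast hn
  have hpos : 0 < (n : ℝ) - 2 := by linarith
  have hu := sqrt_div_p0_pow_le hn
  have hu0 := Real.sqrt_nonneg (2 / (((n : ℝ) - 2) * p0 n ^ n))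
  unfold nstar at hdn
  unfold Kd
  generalize Real.sqrt (2 / (((n : ℝ) - 2) * p0 n ^ n)) = u at hu hu0 ⊢
  have hm : Real.sqrt (2 * n / (((n : ℝ) - 1) * ((n : ℝ) - 2))) ≤ 1 := by
    rw [Real.sqrt_le_one, div_le_one (mul_pos (by linarith) hpos)]
    nlinarith
  have hr : ((2.032 : ℝ) ^ ((1 : ℝ) / n)) ^ d ≤ 2.032 := by
    rw [← Real.rpow_mul (by norm_num)]
    refine (Real.rpow_le_rpow_of_exponent_le (by norm_num) ?_).trans_eq (Real.rpow_one _)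
    rw [one_div_mul_eq_div, div_le_one (by linarith)]
    linarith
  have hdu : u * d ≤ 1 / 4 := by
    calc u * d ≤ 1 / (2 * ((n : ℝ) - 2)) * (((n : ℝ) - 2) / 2) := by gcongr
      _ = 1 / 4 := by field_simp; norm_num
  have hexp : (1 + u) ^ d ≤ Real.exp (1 / 4) := by
    calc (1 + u) ^ d ≤ Real.exp u ^ d := by
          gcongr
          linarith [Real.add_one_le_exp u]
      _ = Real.exp (u * d) := (Real.exp_mul u d).symm
      _ ≤ Real.exp (1 / 4) := Real.exp_le_exp.mpr hdu
  rw [Real.mul_rpow (by positivity) (by positivity)]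
  calc _ ≤ 2 * 1 * (2.032 * Real.exp (1 / 4)) := by gcongr
    _ ≤ 5 * Real.exp (1 / 4) := by linarith [Real.exp_pos (1 / 4)]

theorem stmt11 (n : ℕ) (hn : 9 ≤ n) :
    Kd (nstar n / 2) n ≤ 5 * Real.exp (1 / 4) ∧ Kd (nstar n) n ≤ 5 * Real.exp (1 / 2) := by
  have hn' : (9 : ℝ) ≤ n := by exact_mod_cast hn
  have hs : 0 ≤ nstar n := by unfold nstar; linarith
  refine ⟨Kd_le hn (by linarith) (by linarith), (Kd_le hn hs le_rfl).trans ?_⟩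
  gcongr
  norm_num
end

section
/- Let n ≥ 6 be an integer. Then K_{n*}(n) ≤ 4·e·√(3/(n−2)). -/
theorem natCast_le_p0_pow (n : ℕ) : (n : ℝ) ≤ p0 n ^ n := by
  have h1 : (n : ℝ) ≤ 2 ^ n := by exact_mod_cast Nat.lt_two_pow_self.le
  have h2 : (2 : ℝ) ≤ p0 n := by
    unfold p0
    split_ifs <;> norm_num
  exact h1.trans (pow_le_pow_left₀ (by norm_num) h2 n)

/-- The error term `u_n` is at most `1 / n*`. -/
theorem sqrt_two_div_le_two_div {n : ℕ} (hn : 6 ≤ n) :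
    Real.sqrt (2 / (((n : ℝ) - 2) * p0 n ^ n)) ≤ 2 / ((n : ℝ) - 2) := by
  have hn' : (6 : ℝ) ≤ n := by exact_mod_cast hn
  have hp := natCast_le_p0_pow n
  have hd : 0 < (n : ℝ) - 2 := by linarith
  have hp0 : 0 < p0 n ^ n := by linarith
  refine Real.sqrt_le_iff.mpr ⟨by positivity, ?_⟩
  rw [div_pow, div_le_div_iff₀ (by positivity) (by positivity)]
  nlinarith

theorem one_add_rpow_le_exp_one {u d : ℝ} (hu : 0 ≤ u) (hd : 0 ≤ d) (h : u * d ≤ 1) :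
    (1 + u) ^ d ≤ Real.exp 1 := by
  calc (1 + u) ^ d ≤ Real.exp u ^ d :=
        Real.rpow_le_rpow (by positivity) (by linarith [Real.add_one_le_exp u]) hd
    _ = Real.exp (u * d) := (Real.exp_mul u d).symm
    _ ≤ Real.exp 1 := Real.exp_le_exp.mpr h

theorem rpow_nstar_le_two {n : ℕ} (hn : 6 ≤ n) :
    ((2.032 : ℝ) ^ ((1 : ℝ) / n)) ^ nstar n ≤ 2 := by
  have hn' : (6 : ℝ) ≤ n := by exact_mod_cast hn
  rw [← Real.rpow_mul (by norm_num)]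
  calc (2.032 : ℝ) ^ ((1 : ℝ) / n * nstar n) ≤ 2.032 ^ (1 / 2 : ℝ) := by
        refine Real.rpow_le_rpow_of_exponent_le (by norm_num) ?_
        rw [nstar, div_mul_div_comm, div_le_div_iff₀ (by positivity) (by norm_num)]
        linarith
    _ ≤ 2 := by
        rw [← Real.sqrt_eq_rpow]
        exact Real.sqrt_le_iff.mpr (by norm_num)

theorem stmt12 (n : ℕ) (hn : 6 ≤ n) :
    Kd (nstar n) n ≤ 4 * Real.exp 1 * Real.sqrt (3 / ((n : ℝ) - 2)) := by
  have hn' : (6 : ℝ) ≤ n := by exact_mod_cast hn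
  have hd : 0 < (n : ℝ) - 2 := by linarith
  have hu := sqrt_two_div_le_two_div hn
  have hr := rpow_nstar_le_two hn
  have hs0 : 0 ≤ nstar n := by
    unfold nstar
    linarith
  have hm : Real.sqrt (2 * n / (((n : ℝ) - 1) * ((n : ℝ) - 2))) ≤
      Real.sqrt (3 / ((n : ℝ) - 2)) := by
    refine Real.sqrt_le_sqrt ?_
    rw [div_le_div_iff₀ (mul_pos (by linarith) hd) hd]
    nlinarith
  have he := one_add_rpow_le_exp_one (Real.sqrt_nonneg _) hs0
    (calc _ ≤ 2 / ((n : ℝ) - 2) * nstar n := mul_le_mul_of_nonneg_right hu hs0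
      _ = 1 := by
        unfold nstar
        field_simp)
  rw [Kd, Real.mul_rpow (by positivity) (by positivity)]
  calc _ ≤ 2 * Real.sqrt (3 / ((n : ℝ) - 2)) * (2 * Real.exp 1) := by gcongr
    _ = _ := by ring
end

section
/- Let n ≥ 507 be an integer, let c = 32/45, and let b = 1 − √(2n+1/8)/(c·n²/(n−1)+2). Then 0.87509 < b < 1 − √(2n+1/8)/n, and with a = 1/4 one has E = 1/(2(b² − 1/16)) < 0.711 < 32/45. -/
theorem stmt14 (n : ℕ) (hn : 507 ≤ n)
    (c b a E : ℝ) (hc : c = 32 / 45)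
    (hb : b = 1 - Real.sqrt (2 * n + 1 / 8) / (c * n ^ 2 / ((n : ℝ) - 1) + 2))
    (ha : a = 1 / 4)
    (hE : E = 1 / (2 * (b ^ 2 - a ^ 2))) :
    (0.87509 < b ∧ b < 1 - Real.sqrt (2 * n + 1 / 8) / n) ∧
      (E < 0.711 ∧ (0.711 : ℝ) < 32 / 45) := by
  have hn' : (507 : ℝ) ≤ n := by exact_mod_cast hn
  have hpos : (0 : ℝ) < n := by linarith
  have hpred : (0 : ℝ) < (n : ℝ) - 1 := by linarith
  have hlower : 32 / 45 * (n : ℝ) < c * n ^ 2 / ((n : ℝ) - 1) + 2 := by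
    have h : 32 / 45 * (n : ℝ) ≤ c * n ^ 2 / ((n : ℝ) - 1) := by
      rw [le_div_iff₀ hpred, hc]
      nlinarith
    linarith
  have hupper : c * n ^ 2 / ((n : ℝ) - 1) + 2 < n := by
    have h : c * n ^ 2 / ((n : ℝ) - 1) < n - 2 := by
      rw [div_lt_iff₀ hpred, hc]
      nlinarith
    linarith
  have hden : 0 < c * n ^ 2 / ((n : ℝ) - 1) + 2 := by linarith
  have hsqrt_pos : 0 < Real.sqrt (2 * n + 1 / 8) := Real.sqrt_pos.mpr (by linarith)
  have hsqrt : Real.sqrt (2 * n + 1 / 8) < 0.088 * n := by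
    rw [Real.sqrt_lt' (by linarith)]
    nlinarith
  have hb_lower : 0.87509 < b := by
    have h : Real.sqrt (2 * n + 1 / 8) / (c * n ^ 2 / ((n : ℝ) - 1) + 2) < 0.12491 := by
      rw [div_lt_iff₀ hden]
      linarith
    linarith
  have hb_upper : b < 1 - Real.sqrt (2 * n + 1 / 8) / n := by
    rw [hb]
    exact sub_lt_sub_left (div_lt_div_of_pos_left hsqrt_pos hden hupper) 1
  refine ⟨⟨hb_lower, hb_upper⟩, ?_, by norm_num⟩
  have hgap : 0.70327 < b ^ 2 - a ^ 2 := by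
    rw [ha]
    nlinarith
  rw [hE, div_lt_iff₀ (by linarith)]
  linarith
end
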